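/- There do not exist a totally real number field K of degree n with log|d_K| = n·(π/2 + log(8π) + γ) together with a totally complex number field L (a number field with no real embeddings) of degree m with log|d_L| = m·(log(8π) + γ). (This is the key step of the first part of Theorem 5: a totally real Galois field K with ζ_K(1/2) ≠ 0 and ζ_K'(1/2) = 0 satisfies the first equation, and a totally complex Galois field L with ζ_L(1/2) ≠ 0 and ζ_L'(1/2) = 0 satisfies the second, so at least one of the two sets X and Y is empty.) -/

import Mathlib

lemma factor_zeros (Z : Finset ℂ) : ∀ (f : ℂ → ℂ), Differentiable ℂ f → (∀ u ∈ Z, f u = 0) →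
    ∃ g : ℂ → ℂ, Differentiable ℂ g ∧ ∀ z, f z = (∏ u ∈ Z, (z - u)) * g z := by
  classical
  induction Z using Finset.induction_on with
  | empty => intro f hf _; exact ⟨f, hf, by simp⟩
  | insert v Z hv ih =>
    intro f hf h0
    have hd : Differentiable ℂ (dslope f v) := by
      rw [← differentiableOn_univ]
      exact (Complex.differentiableOn_dslope Filter.univ_mem).2 hf.differentiableOn
    have hfe : ∀ z, f z = (z - v) * dslope f v z := by
      intro z
      have := sub_smul_dslope f v z
      rw [h0 v (Finset.mem_insert_self _ _), sub_zero] at this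
      simpa using this.symm
    obtain ⟨g, hg, hge⟩ := ih (dslope f v) hd (by
      intro u hu
      have h1 := hfe u
      rw [h0 u (Finset.mem_insert_of_mem hu)] at h1
      have h2 : u - v ≠ 0 := sub_ne_zero.2 (fun h => hv (h ▸ hu))
      simpa [h2] using h1.symm)
    refine ⟨g, hg, fun z => ?_⟩
    rw [hfe z, hge z, Finset.prod_insert hv, mul_assoc]

lemma schwarz_zeros (Z : Finset ℂ) (f : ℂ → ℂ) (hf : Differentiable ℂ f)
    (h0 : ∀ u ∈ Z, f u = 0) (s C : ℝ) (hs : 0 < s) (w : ℂ) (hw : ‖w‖ ≤ 2 * s)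
    (hZ : ∀ u ∈ Z, ‖u‖ ≤ 2 * s) (hZw : ∀ u ∈ Z, ‖w - u‖ ≤ 2 * s)
    (hC : ∀ z : ℂ, ‖z‖ = 8 * s → ‖f z‖ ≤ C) : ‖f w‖ ≤ C * (1 / 3) ^ Z.card := by
  obtain ⟨g, hg, hge⟩ := factor_zeros Z f hf h0
  have hb : ‖g w‖ ≤ C / (6 * s) ^ Z.card := by
    refine Complex.norm_le_of_forall_mem_frontier_norm_le (U := Metric.ball 0 (8 * s))
      Metric.isBounded_ball hg.diffContOnCl ?_ ?_
    · intro z hz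
      rw [frontier_ball _ (by positivity)] at hz
      have hz' : ‖z‖ = 8 * s := by simpa using hz
      rw [le_div_iff₀ (by positivity)]
      refine le_trans ?_ (hC z hz')
      rw [hge z, norm_mul, norm_prod, mul_comm]
      gcongr
      rw [← Finset.prod_const]
      refine Finset.prod_le_prod (fun _ _ => by positivity) (fun u hu => ?_)
      have := norm_sub_norm_le z u
      have := hZ u hu
      linarith
    · apply subset_closure
      simp only [Metric.mem_ball, dist_zero_right]
      linarith
  rw [hge w, norm_mul, norm_prod]
  have h1 : ∏ u ∈ Z, ‖w - u‖ ≤ (2 * s) ^ Z.card := by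
    rw [← Finset.prod_const]
    exact Finset.prod_le_prod (fun _ _ => by positivity) hZw
  calc _ ≤ (2 * s) ^ Z.card * (C / (6 * s) ^ Z.card) := by gcongr
    _ = C * ((2 * s) / (6 * s)) ^ Z.card := by rw [div_pow]; ring
    _ = _ := by
      congr 2
      field_simp
      norm_num

/-- The auxiliary exponential polynomial. -/
noncomputable def auxF {M N : ℕ} (c : Fin M × Fin N → ℤ) (α : ℝ) (z : ℂ) : ℂ :=
  ∑ x, (c x : ℂ) * (z ^ (x.1 : ℕ) * Complex.exp (α * (x.2 : ℕ) * z))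

/-- The matrix coefficients as Gaussian integers. -/
def auxE {M N : ℕ} (p d a b : ℕ) (x : Fin M × Fin N) : GaussianInt :=
  (⟨a, b⟩ : GaussianInt) ^ (x.1 : ℕ) * ((p ^ (a * x.2) * d ^ (a * (N - x.2)) : ℕ) : GaussianInt)

lemma auxF_diff {M N : ℕ} (c : Fin M × Fin N → ℤ) (α : ℝ) : Differentiable ℂ (auxF c α) := by
  unfold auxF
  fun_prop

lemma exp_at (h a b j : ℕ) (q : ℝ) (hq : Real.exp (2 * Real.pi * h) = q) :
    Complex.exp (((2 * Real.pi * h : ℝ) : ℂ) * j * ((a : ℂ) + b * Complex.I)) = (q : ℂ) ^ (a * j) := by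
  have : ((2 * Real.pi * h : ℝ) : ℂ) * j * ((a : ℂ) + b * Complex.I) =
     (a * j : ℕ) * ((2 * Real.pi * h : ℝ) : ℂ) + (h * j * b : ℕ) * (2 * Real.pi * Complex.I) := by
    push_cast; ring
  rw [this, Complex.exp_add, Complex.exp_nat_mul_two_pi_mul_I, mul_one, Complex.exp_nat_mul,
    ← Complex.ofReal_exp, hq]

lemma toC (a b : ℕ) : GaussianInt.toComplex (⟨a, b⟩ : GaussianInt) = (a : ℂ) + b * Complex.I := by
  simp [GaussianInt.toComplex_def]

lemma auxF_value {M N : ℕ} (c : Fin M × Fin N → ℤ) (h p d : ℕ) (hd : 0 < d)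
    (hq : Real.exp (2 * Real.pi * h) = (p : ℝ) / d) (a b : ℕ) :
    (d : ℂ) ^ (a * N) * auxF c (2 * Real.pi * h) ((a : ℂ) + b * Complex.I) =
      GaussianInt.toComplex (∑ x, (c x : GaussianInt) * auxE p d a b x) := by
  have hd' : (d : ℂ) ≠ 0 := by exact_mod_cast hd.ne'
  rw [auxF, Finset.mul_sum, map_sum]
  refine Finset.sum_congr rfl fun x _ => ?_
  rw [exp_at h a b x.2 _ hq]
  simp only [auxE, map_mul, map_pow, toC, map_intCast, map_natCast]
  push_cast
  have : a * N = a * x.2 + a * (N - x.2) := by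
    rw [← mul_add, Nat.add_sub_cancel' x.2.2.le]
  rw [this, pow_add, div_pow]
  field_simp

lemma norm_pt (a b s : ℕ) (ha : a ≤ s) (hb : b ≤ s) : ‖(a : ℂ) + b * Complex.I‖ ≤ 2 * s := by
  refine (norm_add_le _ _).trans ?_
  have ha' : (a : ℝ) ≤ s := by exact_mod_cast ha
  have hb' : (b : ℝ) ≤ s := by exact_mod_cast hb
  simp
  linarith

lemma auxE_norm {M N : ℕ} (p d a b S : ℕ) (hd : 0 < d) (hdp : d ≤ p) (ha : a ≤ S) (hb : b ≤ S)
    (hS : 0 < S) (x : Fin M × Fin N) :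
    ‖GaussianInt.toComplex (auxE p d a b x)‖ ≤ (2 * S) ^ M * (p : ℝ) ^ (S * N) := by
  simp only [auxE, map_mul, map_pow, toC, map_natCast, norm_mul, norm_pow, Complex.norm_natCast]
  have hS' : (1 : ℝ) ≤ S := by exact_mod_cast hS
  have hp' : (1 : ℝ) ≤ p := by exact_mod_cast (hd.trans_le hdp)
  have hdp' : (d : ℝ) ≤ p := by exact_mod_cast hdp
  gcongr
  · calc _ ≤ (2 * (S : ℝ)) ^ (x.1 : ℕ) := by gcongr; exact norm_pt a b S ha hb
      _ ≤ _ := pow_le_pow_right₀ (by linarith) x.1.2.le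
  · push_cast
    calc (p : ℝ) ^ (a * x.2) * (d : ℝ) ^ (a * (N - x.2)) ≤
        (p : ℝ) ^ (a * x.2) * (p : ℝ) ^ (a * (N - x.2)) := by gcongr
      _ = (p : ℝ) ^ (a * N) := by
        rw [← pow_add, ← mul_add, Nat.add_sub_cancel' x.2.2.le]
      _ ≤ _ := pow_le_pow_right₀ hp' (by gcongr)

lemma auxF_bound {M N : ℕ} (c : Fin M × Fin N → ℤ) (α : ℝ) (hα : 0 ≤ α) (C R : ℝ) (hR : 1 ≤ R)
    (hc : ∀ x, |(c x : ℝ)| ≤ C) (hC : 0 ≤ C) (z : ℂ) (hz : ‖z‖ = R) :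
    ‖auxF c α z‖ ≤ M * N * (C * (R ^ M * Real.exp (α * N * R))) := by
  unfold auxF
  refine (norm_sum_le_of_le (f := fun x : Fin M × Fin N => (c x : ℂ) * (z ^ (x.1 : ℕ) * Complex.exp (α * (x.2 : ℕ) * z))) (n := fun _ => C * (R ^ M * Real.exp (α * N * R))) _ ?_).trans ?_
  · intro x _
    rw [norm_mul, norm_mul, norm_pow, hz, Complex.norm_exp, Complex.norm_intCast]
    have h1 : ((α : ℂ) * (x.2 : ℕ) * z).re ≤ α * N * R := by
      refine (Complex.re_le_norm _).trans ?_
      rw [norm_mul, norm_mul, hz, Complex.norm_natCast, Complex.norm_real, Real.norm_of_nonneg hα]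
      have : ((x.2 : ℕ) : ℝ) ≤ N := by exact_mod_cast x.2.2.le
      gcongr
    have := hc x
    gcongr
    exact x.1.2.le
  · simp

lemma siegel_step (M N S p d : ℕ) (hS : 0 < S) (hMN : M * N = 4 * S ^ 2) (hd : 0 < d) (hdp : d ≤ p) :
    ∃ c : Fin M × Fin N → ℤ, c ≠ 0 ∧
      (∀ x, |(c x : ℝ)| ≤ M * N * ((2 * S) ^ M * (p : ℝ) ^ (S * N))) ∧
      ∀ a b : ℕ, a < S → b < S → ∑ x, (c x : GaussianInt) * auxE p d a b x = 0 := by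
  let A : Matrix ((Fin S × Fin S) × Bool) (Fin M × Fin N) ℤ := fun r x =>
    if r.2 then (auxE p d r.1.1 r.1.2 x).re else (auxE p d r.1.1 r.1.2 x).im
  have hS' : (1 : ℝ) ≤ S := by exact_mod_cast hS
  have hp' : (1 : ℝ) ≤ p := by exact_mod_cast (hd.trans_le hdp)
  have hB1 : (1 : ℝ) ≤ (2 * S) ^ M * (p : ℝ) ^ (S * N) :=
    one_le_mul_of_one_le_of_one_le (one_le_pow₀ (by linarith)) (one_le_pow₀ hp')

  have hA : max 1 (@norm _ Matrix.seminormedAddCommGroup.toNorm A) ≤ (2 * S) ^ M * (p : ℝ) ^ (S * N) := by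
    refine max_le hB1 ?_
    refine (Matrix.norm_le_iff (by positivity)).2 fun r x => ?_
    have h1 := auxE_norm p d r.1.1 r.1.2 S hd hdp r.1.1.2.le r.1.2.2.le hS x
    refine le_trans ?_ h1
    rw [Int.norm_eq_abs]
    simp only [A]
    split_ifs
    · rw [GaussianInt.intCast_re]; exact Complex.abs_re_le_norm _
    · rw [GaussianInt.intCast_im]; exact Complex.abs_im_le_norm _
  have hS2 : 0 < S ^ 2 := by positivity
  have cα : Fintype.card ((Fin S × Fin S) × Bool) = 2 * S ^ 2 := by simp; ring
  have cβ : Fintype.card (Fin M × Fin N) = 4 * S ^ 2 := by simpa using hMN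
  obtain ⟨c, hc0, hAc, hcn⟩ := Int.Matrix.exists_ne_zero_int_vec_norm_le A (by omega) (by omega)
  refine ⟨c, hc0, fun x => ?_, fun a b ha hb => ?_⟩
  · have h1 : |(c x : ℝ)| ≤ ‖c‖ := by rw [← Int.norm_eq_abs]; exact norm_le_pi_norm c x
    refine h1.trans (hcn.trans ?_)
    have he : ((Fintype.card ((Fin S × Fin S) × Bool) : ℝ) / ((Fintype.card (Fin M × Fin N) : ℝ) - (Fintype.card ((Fin S × Fin S) × Bool) : ℝ))) = 1 := by
      rw [cα, cβ]; push_cast; field_simp; norm_num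
    rw [he, Real.rpow_one, cβ, ← hMN]
    push_cast
    gcongr
  · have key : ∀ t : Bool, ∑ x, A ((⟨a, ha⟩, ⟨b, hb⟩), t) x * c x = 0 := fun t => congrFun hAc ((⟨a, ha⟩, ⟨b, hb⟩), t)
    have hre := key true
    have him := key false
    simp only [A] at hre him
    apply GaussianInt.toComplex_injective
    rw [map_zero, map_sum]
    apply Complex.ext
    · rw [Complex.re_sum, Complex.zero_re]
      have : ((∑ x, (auxE p d a b x).re * c x : ℤ) : ℝ) = 0 := by exact_mod_cast (by simpa using hre)
      rw [← this]; push_cast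
      refine Finset.sum_congr rfl fun x _ => ?_
      simp [mul_comm]
    · rw [Complex.im_sum, Complex.zero_im]
      have : ((∑ x, (auxE p d a b x).im * c x : ℤ) : ℝ) = 0 := by exact_mod_cast (by simpa using him)
      rw [← this]; push_cast
      refine Finset.sum_congr rfl fun x _ => ?_
      simp [mul_comm]

lemma log_small (T : ℕ) : ∃ N : ℕ, ∀ s : ℕ, N ≤ s → 0 < s →
    (8 * T + 4) * Real.log (8 * s) < (s : ℝ) / 2 := by
  have hc : (0 : ℝ) < 1 / (32 * (8 * T + 4)) := by positivity
  have h1 := Real.isLittleO_log_id_atTop.bound hc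
  have h2 : Filter.Tendsto (fun s : ℕ => 8 * (s : ℝ)) Filter.atTop Filter.atTop :=
    Filter.Tendsto.const_mul_atTop (by norm_num) tendsto_natCast_atTop_atTop
  obtain ⟨N, hN⟩ := Filter.eventually_atTop.1 (h2.eventually h1)
  refine ⟨N, fun s hs hs0 => ?_⟩
  have hs0' : (0 : ℝ) < s := by exact_mod_cast hs0
  have h3 := hN s hs
  simp only [id, Real.norm_eq_abs] at h3
  rw [abs_of_pos (show (0 : ℝ) < 8 * s by positivity)] at h3
  have h4 := (le_abs_self _).trans h3
  calc (8 * T + 4) * Real.log (8 * s) ≤ (8 * T + 4) * (1 / (32 * (8 * T + 4)) * (8 * s)) := by gcongr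
    _ = s / 4 := by field_simp; norm_num
    _ < s / 2 := by linarith

lemma numeric (α : ℝ) (hα : 0 ≤ α) (p : ℕ) (hp : 0 < p) : ∃ T N : ℕ, 0 < T ∧ 0 < N ∧
    ∀ s : ℕ, T * N ≤ s → ∀ M S : ℕ, M = 4 * T * S → S = T * N →
    (p : ℝ) ^ (s * N) * (M * N * ((M * N * ((2 * S) ^ M * (p : ℝ) ^ (S * N))) *
      ((8 * s) ^ M * Real.exp (α * N * (8 * s)))) * (1 / 3) ^ (s * s)) < 1 := by
  obtain ⟨T, hT⟩ := exists_nat_ge (2 * (2 * Real.log p + 8 * α) + 1)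
  have hp1 : (1 : ℝ) ≤ p := by exact_mod_cast hp
  have hlp : 0 ≤ Real.log p := Real.log_nonneg hp1
  have hT1 : (1 : ℝ) ≤ T := by linarith
  have hT0 : 0 < T := by exact_mod_cast (by linarith : (0 : ℝ) < T)
  obtain ⟨N, hN⟩ := log_small T
  refine ⟨T, N + 1, hT0, N.succ_pos, fun s hs M S hM hS => ?_⟩
  have hsN : N + 1 ≤ s := le_trans (Nat.le_mul_of_pos_left _ hT0) hs
  have hs0 : 0 < s := by omega
  have hl := hN s (by omega) hs0
  generalize hN' : N + 1 = n at *
  have hs1 : (1 : ℝ) ≤ s := by exact_mod_cast hs0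
  have hSs : (S : ℝ) ≤ s := by rw [hS]; exact_mod_cast hs
  have hTn : (T : ℝ) * n ≤ s := by exact_mod_cast hs
  have hMr : (M : ℝ) = 4 * T * S := by rw [hM]; push_cast; rfl
  have hSr : (S : ℝ) = T * n := by rw [hS]; push_cast; rfl
  have hMN : (M : ℝ) * n ≤ (8 * s) ^ 2 := by
    have : (M : ℝ) * n = 4 * S ^ 2 := by rw [hMr, hSr]; ring
    rw [this]
    have h0 : (0 : ℝ) ≤ S := by positivity
    nlinarith
  have e8 : (8 * s : ℝ) = Real.exp (Real.log (8 * s)) := (Real.exp_log (by positivity)).symm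
  have ep : (p : ℝ) = Real.exp (Real.log p) := (Real.exp_log (by positivity)).symm
  have hL : 0 ≤ Real.log (8 * s) := Real.log_nonneg (by linarith)
  calc _ ≤ (p : ℝ) ^ (s * n) * ((8 * s) ^ 2 * (((8 * s) ^ 2 * ((8 * s) ^ M * (p : ℝ) ^ (s * n))) *
      ((8 * s) ^ M * Real.exp (α * n * (8 * s)))) * Real.exp (-1) ^ (s * s)) := by
        gcongr
        · norm_num
        · rw [hS]; exact hs
        · rw [Real.exp_neg, one_div]
          exact inv_anti₀ (Real.exp_pos _) Real.exp_one_lt_three.le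
    _ = Real.exp ((2 * M + 4) * Real.log (8 * s) + s * n * (2 * Real.log p + 8 * α) - s * s) := by
        set L := Real.log (8 * s)
        set l := Real.log p
        rw [e8, ep]
        simp only [← Real.exp_nat_mul, ← Real.exp_add]
        congr 1
        rw [← e8]
        push_cast
        ring
    _ < 1 := by
        rw [Real.exp_lt_one_iff]
        have hn0 : (0 : ℝ) ≤ n := by positivity
        have h1 : (2 * M + 4 : ℝ) * Real.log (8 * s) ≤ s * ((8 * T + 4) * Real.log (8 * s)) := by
          rw [← mul_assoc]
          gcongr
          rw [hMr]
          nlinarith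
        have h2 : s * ((8 * T + 4) * Real.log (8 * s)) < s * ((s : ℝ) / 2) := by gcongr
        have h3 : s * n * (2 * Real.log p + 8 * α) ≤ s * ((s : ℝ) / 2) := by
          rw [mul_assoc]
          gcongr
          nlinarith
        linarith

lemma poly_zero {M N : ℕ} (c : Fin M × Fin N → ℤ) (h : ℕ) (q : ℝ) (hq1 : 1 < q)
    (hq : Real.exp (2 * Real.pi * h) = q)
    (h0 : ∀ a b : ℕ, auxF c (2 * Real.pi * h) ((a : ℂ) + b * Complex.I) = 0) : c = 0 := by
  have h1 : ∀ a : ℕ, ∀ i : Fin M, ∑ j : Fin N, (c (i, j) : ℂ) * ((q : ℂ) ^ a) ^ (j : ℕ) = 0 := by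
    intro a
    have := Matrix.eq_zero_of_forall_index_sum_mul_pow_eq_zero
      (f := fun b : Fin M => (a : ℂ) + (b : ℕ) * Complex.I)
      (v := fun i => ∑ j : Fin N, (c (i, j) : ℂ) * ((q : ℂ) ^ a) ^ (j : ℕ)) ?_ ?_
    · exact fun i => congrFun this i
    · intro x y hxy
      have : ((x : ℕ) : ℂ) = (y : ℕ) := by simpa using hxy
      exact Fin.ext (by exact_mod_cast this)
    · intro b
      rw [← h0 a b, auxF, Fintype.sum_prod_type]
      refine Finset.sum_congr rfl fun i _ => ?_
      rw [Finset.sum_mul]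
      refine Finset.sum_congr rfl fun j _ => ?_
      rw [exp_at h a b j q hq, pow_mul]
      ring
  funext ⟨i, j⟩
  have h2 := Matrix.eq_zero_of_forall_index_sum_mul_pow_eq_zero
      (f := fun a : Fin N => (q : ℂ) ^ (a : ℕ)) (v := fun j => (c (i, j) : ℂ)) ?_ ?_
  · have := congrFun h2 j
    simpa using this
  · intro x y hxy
    have : q ^ (x : ℕ) = q ^ (y : ℕ) := by simpa only [← Complex.ofReal_pow, Complex.ofReal_inj] using hxy
    exact Fin.ext (pow_right_injective₀ (by linarith) hq1.ne' this)
  · intro a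
    exact h1 a i

lemma norm_gauss (x : GaussianInt) (hx : x ≠ 0) : 1 ≤ ‖GaussianInt.toComplex x‖ := by
  have h1 : (0 : ℤ) < x.norm := GaussianInt.norm_pos.2 hx
  have h2 : ((x.norm : ℤ) : ℝ) = Complex.normSq (GaussianInt.toComplex x) :=
    GaussianInt.intCast_real_norm x
  have h3 : (1 : ℝ) ≤ ‖GaussianInt.toComplex x‖ ^ 2 := by
    rw [← Complex.normSq_eq_norm_sq, ← h2]
    exact_mod_cast h1
  nlinarith [norm_nonneg (GaussianInt.toComplex x)]

/-- Gelfond: no positive power of `exp (2 π)` is rational. -/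
theorem exp_two_pi_irrational (h p d : ℕ) (hh : 0 < h) (hd : 0 < d)
    (hq : Real.exp (2 * Real.pi * h) = (p : ℝ) / d) : False := by
  have hα : 0 < 2 * Real.pi * h := by have := Real.pi_pos; positivity
  have hq1 : (1 : ℝ) < (p : ℝ) / d := by rw [← hq]; exact Real.one_lt_exp_iff.2 hα
  have hd' : (0 : ℝ) < d := by exact_mod_cast hd
  have hdp : d ≤ p := by
    rw [one_lt_div hd'] at hq1
    exact_mod_cast hq1.le
  have hp0 : 0 < p := hd.trans_le hdp
  obtain ⟨T, N, hT, hN, hnum⟩ := numeric _ hα.le p hp0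
  obtain ⟨S, hS⟩ : ∃ S, S = T * N := ⟨_, rfl⟩
  obtain ⟨M, hM⟩ : ∃ M, M = 4 * T * S := ⟨_, rfl⟩
  have hS0 : 0 < S := by rw [hS]; positivity
  obtain ⟨c, hc0, hcb, hcz⟩ := siegel_step M N S p d hS0 (by rw [hM, hS]; ring) hd hdp
  have hval := auxF_value c h p d hd hq
  have hdc : (d : ℂ) ≠ 0 := by exact_mod_cast hd.ne'
  have hz : ∀ s, S ≤ s → ∀ a b : ℕ, a < s → b < s →
      auxF c (2 * Real.pi * h) ((a : ℂ) + b * Complex.I) = 0 := by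
    intro s hs
    induction s, hs using Nat.le_induction with
    | base =>
      intro a b ha hb
      have := hval a b
      rw [hcz a b ha hb, map_zero] at this
      exact (mul_eq_zero.1 this).resolve_left (pow_ne_zero _ hdc)
    | succ s hs ih =>
      intro a b ha hb
      have ha' : a ≤ s := by omega
      have hb' : b ≤ s := by omega
      have hs0 : 0 < s := by omega
      have hs0' : (1 : ℝ) ≤ s := by exact_mod_cast hs0
      by_contra hne
      let e : Fin s × Fin s → ℂ := fun x => ((x.1 : ℕ) : ℂ) + ((x.2 : ℕ) : ℂ) * Complex.I
      have he : Function.Injective e := by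
        rintro ⟨x, y⟩ ⟨x', y'⟩ hxy
        have h1 := congrArg Complex.re hxy
        have h2 := congrArg Complex.im hxy
        simp [e] at h1 h2
        exact Prod.ext (Fin.ext h1) (Fin.ext h2)
      classical
      have key := schwarz_zeros (Finset.univ.image e) (auxF c (2 * Real.pi * h)) (auxF_diff _ _) ?_ s
        _ (by positivity) ((a : ℂ) + b * Complex.I) (norm_pt a b s ha' hb') ?_ ?_
        (fun z hz => auxF_bound c _ hα.le _ (8 * s) (by linarith) hcb (by positivity) z hz)
      · rw [Finset.card_image_of_injective _ he, Finset.card_univ, Fintype.card_prod,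
          Fintype.card_fin] at key
        have hlow : 1 ≤ (d : ℝ) ^ (a * N) * ‖auxF c (2 * Real.pi * h) ((a : ℂ) + b * Complex.I)‖ := by
          have h1 := congrArg norm (hval a b)
          rw [norm_mul, norm_pow, Complex.norm_natCast] at h1
          rw [h1]
          apply norm_gauss
          intro h2
          have h3 := hval a b
          rw [h2, map_zero] at h3
          exact hne ((mul_eq_zero.1 h3).resolve_left (pow_ne_zero _ hdc))
        have hdpow : (d : ℝ) ^ (a * N) ≤ (p : ℝ) ^ (s * N) := by
          have hp1 : (1 : ℝ) ≤ p := by exact_mod_cast hp0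
          calc (d : ℝ) ^ (a * N) ≤ (p : ℝ) ^ (a * N) := by gcongr
            _ ≤ _ := pow_le_pow_right₀ hp1 (by gcongr)
        have := hnum s (hS ▸ hs) M S hM hS
        have h5 := mul_le_mul hdpow key (norm_nonneg _) (by positivity)
        linarith
      · intro u hu
        obtain ⟨x, -, rfl⟩ := Finset.mem_image.1 hu
        exact ih _ _ x.1.2 x.2.2
      · intro u hu
        obtain ⟨x, -, rfl⟩ := Finset.mem_image.1 hu
        exact norm_pt _ _ s x.1.2.le x.2.2.le
      · intro u hu
        obtain ⟨x, -, rfl⟩ := Finset.mem_image.1 hu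
        refine (Complex.norm_le_abs_re_add_abs_im _).trans ?_
        have hx1 : ((x.1 : ℕ) : ℝ) ≤ s := by exact_mod_cast x.1.2.le
        have hx2 : ((x.2 : ℕ) : ℝ) ≤ s := by exact_mod_cast x.2.2.le
        have ha2 : (a : ℝ) ≤ s := by exact_mod_cast ha'
        have hb2 : (b : ℝ) ≤ s := by exact_mod_cast hb'
        have g1 : |(a : ℝ) - (x.1 : ℕ)| ≤ s := by
          rw [abs_le]; constructor <;> linarith [Nat.cast_nonneg (α := ℝ) a, Nat.cast_nonneg (α := ℝ) (x.1 : ℕ)]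
        have g2 : |(b : ℝ) - (x.2 : ℕ)| ≤ s := by
          rw [abs_le]; constructor <;> linarith [Nat.cast_nonneg (α := ℝ) b, Nat.cast_nonneg (α := ℝ) (x.2 : ℕ)]
        simp [e]
        linarith
  refine hc0 (poly_zero c h _ hq1 hq fun a b => ?_)
  exact hz (S + a + b + 1) (by omega) a b (by omega) (by omega)


/-- **Key step of the first part of Theorem 5.** There do not exist a totally real
number field `K` of degree `n` with `log|d_K| = n(π/2 + log(8π) + γ)` together with a
totally complex number field `L` of degree `m` with `log|d_L| = m(log(8π) + γ)`. -/
theorem no_totally_real_and_totally_complex_with_critical_discr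
    (K L : Type*) [Field K] [NumberField K] [Field L] [NumberField L]
    (hKreal : ∀ φ : K →+* ℂ, NumberField.ComplexEmbedding.IsReal φ)
    (hKd : Real.log |(NumberField.discr K : ℝ)| =
      (Module.finrank ℚ K : ℝ) *
        (Real.pi / 2 + Real.log (8 * Real.pi) + Real.eulerMascheroniConstant))
    (hLcomplex : ∀ φ : L →+* ℂ, ¬ NumberField.ComplexEmbedding.IsReal φ)
    (hLd : Real.log |(NumberField.discr L : ℝ)| =
      (Module.finrank ℚ L : ℝ) *
        (Real.log (8 * Real.pi) + Real.eulerMascheroniConstant)) :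
    False := by

  have hn : 0 < Module.finrank ℚ K := Module.finrank_pos
  have hm : 0 < Module.finrank ℚ L := Module.finrank_pos
  have hK0 : NumberField.discr K ≠ 0 := NumberField.discr_ne_zero K
  have hL0 : NumberField.discr L ≠ 0 := NumberField.discr_ne_zero L
  generalize Module.finrank ℚ K = n at *
  generalize Module.finrank ℚ L = m at *
  have eK : |(NumberField.discr K : ℝ)| = ((NumberField.discr K).natAbs : ℝ) := by
    rw [Nat.cast_natAbs]; push_cast; rfl
  have eL : |(NumberField.discr L : ℝ)| = ((NumberField.discr L).natAbs : ℝ) := by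
    rw [Nat.cast_natAbs]; push_cast; rfl
  rw [eK] at hKd
  rw [eL] at hLd
  have pK : 0 < (NumberField.discr K).natAbs := Int.natAbs_pos.2 hK0
  have pL : 0 < (NumberField.discr L).natAbs := Int.natAbs_pos.2 hL0
  generalize (NumberField.discr K).natAbs = A at *
  generalize (NumberField.discr L).natAbs = B at *
  have pA : (0 : ℝ) < A := by exact_mod_cast pK
  have pB : (0 : ℝ) < B := by exact_mod_cast pL
  refine exp_two_pi_irrational (n * m) (A ^ (4 * m)) (B ^ (4 * n)) (by positivity) (by positivity) ?_
  rw [← Real.exp_log (show (0 : ℝ) < ((A ^ (4 * m) : ℕ) : ℝ) / ((B ^ (4 * n) : ℕ) : ℝ) by positivity)]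
  congr 1
  push_cast
  rw [Real.log_div (by positivity) (by positivity), Real.log_pow, Real.log_pow, hKd, hLd]
  push_cast
  ring
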